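/- Let N₃ be the quotient of the additive monoid ℕ by the additive congruence generated by the single pair (3, 4), and let S be the additive submonoid of N₃ generated by the class [2] (underlying set {[0],[2],[3]}). Then S is weakly projective in the variety generated by N₃: for every additive monoid A satisfying 3 • a = 4 • a for all a : A, and every surjective additive monoid homomorphism h : A →+ S, there exists an injective additive monoid homomorphism f : S →+ A. (Every algebra in the variety generated by N₃ satisfies the identity 3x ≈ 4x, so this shows every homomorphic preimage of S in the variety contains an isomorphic copy of S.) -/

import Mathlib

/-- The additive congruence on `ℕ` generated by the single pair `(3, 4)`. -/
def truncCon : AddCon ℕ := addConGen (fun a b => a = 3 ∧ b = 4)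

/-- `N₃`: the monoid `{0,1,2,3}` with addition truncated at `3`, as the quotient of `ℕ`
by the additive congruence generated by `(3,4)`. -/
abbrev N3 : Type := truncCon.Quotient

/-- The additive submonoid of `N₃` generated by the class of `2`;
its underlying set is `{[0],[2],[3]}`. -/
def S : AddSubmonoid N3 := AddSubmonoid.closure {((2 : ℕ) : N3)}

/-- Congruent naturals have the same truncation at `3`. -/
theorem min_three_eq_of_truncCon {a b : ℕ} (hab : truncCon a b) : min a 3 = min b 3 := by
  let c : AddCon ℕ :=
    { r := fun a b => min a 3 = min b 3
      iseqv := ⟨fun _ => rfl, fun h => h.symm, fun h₁ h₂ => h₁.trans h₂⟩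
      add' := fun {w x y z} h₁ h₂ => by
        change min w 3 = min x 3 at h₁
        change min y 3 = min z 3 at h₂
        omega }
  have hle : truncCon ≤ c := AddCon.addConGen_le.2 fun a b h => by
    obtain ⟨rfl, rfl⟩ := h
    change min 3 3 = min 4 3
    rfl
  exact hle hab

theorem N3.coe_three_eq_coe_four : ((3 : ℕ) : N3) = ((4 : ℕ) : N3) :=
  (AddCon.eq truncCon).2 (AddConGen.Rel.of _ _ ⟨rfl, rfl⟩)

theorem N3.coe_five_eq_coe_three : ((5 : ℕ) : N3) = ((3 : ℕ) : N3) := by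
  have h : ((5 : ℕ) : N3) = ((4 : ℕ) : N3) :=
    (congrArg (· + ((1 : ℕ) : N3)) N3.coe_three_eq_coe_four).symm
  exact h.trans N3.coe_three_eq_coe_four.symm

theorem N3.coe_six_eq_coe_three : ((6 : ℕ) : N3) = ((3 : ℕ) : N3) := by
  have h : ((6 : ℕ) : N3) = ((5 : ℕ) : N3) :=
    (congrArg (· + ((2 : ℕ) : N3)) N3.coe_three_eq_coe_four).symm
  exact h.trans N3.coe_five_eq_coe_three

theorem N3.coe_ne_coe {a b : ℕ} (hab : min a 3 ≠ min b 3) : (a : N3) ≠ (b : N3) :=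
  fun h => hab (min_three_eq_of_truncCon ((AddCon.eq truncCon).1 h))

theorem N3.two_add_two : ((2 : ℕ) : N3) + ((2 : ℕ) : N3) = ((3 : ℕ) : N3) :=
  N3.coe_three_eq_coe_four.symm

theorem N3.two_add_three : ((2 : ℕ) : N3) + ((3 : ℕ) : N3) = ((3 : ℕ) : N3) :=
  N3.coe_five_eq_coe_three

theorem N3.three_add_two : ((3 : ℕ) : N3) + ((2 : ℕ) : N3) = ((3 : ℕ) : N3) :=
  N3.coe_five_eq_coe_three

theorem N3.three_add_three : ((3 : ℕ) : N3) + ((3 : ℕ) : N3) = ((3 : ℕ) : N3) :=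
  N3.coe_six_eq_coe_three

theorem N3.two_ne_zero : ((2 : ℕ) : N3) ≠ 0 :=
  N3.coe_ne_coe (b := 0) (by decide)

theorem N3.three_ne_zero : ((3 : ℕ) : N3) ≠ 0 :=
  N3.coe_ne_coe (b := 0) (by decide)

theorem N3.three_ne_two : ((3 : ℕ) : N3) ≠ ((2 : ℕ) : N3) :=
  N3.coe_ne_coe (by decide)

theorem eq_of_mem_S {x : N3} (hx : x ∈ S) :
    x = 0 ∨ x = ((2 : ℕ) : N3) ∨ x = ((3 : ℕ) : N3) := by
  induction hx using AddSubmonoid.closure_induction with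
  | mem x hx => exact Or.inr (Or.inl hx)
  | zero => exact Or.inl rfl
  | add x y _ _ hx hy =>
    rcases hx with rfl | rfl | rfl <;> rcases hy with rfl | rfl | rfl <;>
      simp [N3.two_add_two, N3.two_add_three, N3.three_add_two, N3.three_add_three]

open Classical in
/-- An element `b` with `3 • b = 2 • b` and `0`, `b`, `2 • b` distinct generates a copy of `S`. -/
theorem exists_injective_of_three_nsmul_eq {A : Type*} [AddMonoid A] (b : A)
    (hb : 3 • b = 2 • b) (hb0 : b ≠ 0) (h2b0 : 2 • b ≠ 0) (h2b : 2 • b ≠ b) :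
    ∃ f : S →+ A, Function.Injective f := by
  have h22 : b + b = 2 • b := (two_nsmul b).symm
  have h23 : b + 2 • b = 2 • b := by rw [← succ_nsmul', hb]
  have h32 : 2 • b + b = 2 • b := by rw [← succ_nsmul, hb]
  have h33 : 2 • b + 2 • b = 2 • b := by
    nth_rewrite 2 [two_nsmul]
    rw [← add_assoc, h32, h32]
  let g : N3 → A := fun x => if x = 0 then 0 else if x = ((2 : ℕ) : N3) then b else 2 • b
  have g0 : g 0 = 0 := if_pos rfl
  have g2 : g ((2 : ℕ) : N3) = b := by simp only [g, if_neg N3.two_ne_zero, if_true]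
  have g3 : g ((3 : ℕ) : N3) = 2 • b := by
    simp only [g, if_neg N3.three_ne_zero, if_neg N3.three_ne_two]
  refine ⟨⟨⟨fun x => g x, g0⟩, ?_⟩, ?_⟩
  · rintro ⟨x, hx⟩ ⟨y, hy⟩
    change g (x + y) = g x + g y
    rcases eq_of_mem_S hx with rfl | rfl | rfl <;> rcases eq_of_mem_S hy with rfl | rfl | rfl <;>
      simp only [N3.two_add_two, N3.two_add_three, N3.three_add_two, N3.three_add_three,
        zero_add, add_zero, g0, g2, g3, h22, h23, h32, h33]
  · rintro ⟨x, hx⟩ ⟨y, hy⟩ hxy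
    change g x = g y at hxy
    apply Subtype.ext
    change x = y
    rcases eq_of_mem_S hx with rfl | rfl | rfl <;> rcases eq_of_mem_S hy with rfl | rfl | rfl <;>
      simp only [g0, g2, g3] at hxy <;>
      first | rfl | exact absurd hxy ‹_› | exact absurd hxy.symm ‹_›

/-- `S` is weakly projective in the variety generated by `N₃`: whenever `S` is a homomorphic
image of an additive monoid satisfying the identity `3x ≈ 4x`, it embeds into it. -/
theorem S_weakly_projective (A : Type*) [AddMonoid A] (hA : ∀ a : A, 3 • a = 4 • a)
    (h : A →+ S) (hsurj : Function.Surjective h) :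
    ∃ f : S →+ A, Function.Injective f := by
  obtain ⟨a, ha⟩ := hsurj ⟨((2 : ℕ) : N3), AddSubmonoid.subset_closure rfl⟩
  have ha0 : a ≠ 0 := by
    rintro rfl
    rw [map_zero] at ha
    exact N3.two_ne_zero (congrArg Subtype.val ha).symm
  have h2a0 : 2 • a ≠ 0 := by
    intro h0
    have h1 : h a + h a = 0 := by rw [← map_add, ← two_nsmul, h0, map_zero]
    rw [ha] at h1
    exact N3.three_ne_zero (N3.two_add_two.symm.trans (congrArg Subtype.val h1))
  have h2a : 2 • a ≠ a := by
    intro h0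
    have h1 : h a + h a = h a := by rw [← map_add, ← two_nsmul, h0]
    rw [ha] at h1
    exact N3.three_ne_two (N3.two_add_two.symm.trans (congrArg Subtype.val h1))
  by_cases h32 : 3 • a = 2 • a
  · exact exists_injective_of_three_nsmul_eq a h32 ha0 h2a0 h2a
  have h4 : 4 • a = 3 • a := (hA a).symm
  have h5 : 5 • a = 4 • a :=
    (succ_nsmul a 4).trans ((congrArg (· + a) h4).trans (succ_nsmul a 3).symm)
  have h6 : 6 • a = 5 • a :=
    (succ_nsmul a 5).trans ((congrArg (· + a) h5).trans (succ_nsmul a 4).symm)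
  refine exists_injective_of_three_nsmul_eq (2 • a) ?_ h2a0 ?_ ?_
  · rw [← mul_nsmul, ← mul_nsmul]
    exact h6.trans h5
  · rw [← mul_nsmul]
    intro h0
    have h4a : 4 • a = 0 := h0
    have h6a : 6 • a = 4 • a + 2 • a := add_nsmul a 4 2
    rw [h6, h5, h4a, zero_add] at h6a
    exact h2a0 h6a.symm
  · rw [← mul_nsmul]
    exact fun h0 => h32 (h4.symm.trans h0)
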